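/- arXiv:2102.09432 — 4 statements merged into one kernel-verified Lean document; each statement's English description precedes it below -/
import Mathlib

section
/- Let N be a nonempty finite set, let m : N → ℝ satisfy 0 ≤ m(x) ≤ 1 for every x ∈ N, and let k be a natural number with k ≤ |N|. Set d := k · (∑_{x∈N} m(x)) / |N|. Then there exists a subset S ⊆ N with |S| = k such that d − 1 ≤ ∑_{x∈S} m(x) ≤ d + 1. -/
/-- If weights in `[-1, 1]` on a finite set sum to zero, then there are subsets of every
possible size whose total weight is again in `[-1, 1]`. -/
theorem exists_subset_card_eq_abs_sum_le_one {α : Type*} (N : Finset α) (f : α → ℝ)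
    (hf : ∀ x ∈ N, |f x| ≤ 1) (hsum : ∑ x ∈ N, f x = 0) (k : ℕ) (hk : k ≤ N.card) :
    ∃ S ⊆ N, S.card = k ∧ |∑ x ∈ S, f x| ≤ 1 := by
  classical
  induction k with
  | zero => exact ⟨∅, by simp⟩
  | succ k ih =>
    obtain ⟨S, hSN, hcard, hS⟩ := ih (by omega)
    have hne : (N \ S).Nonempty := by
      rw [← Finset.card_pos, Finset.card_sdiff_of_subset hSN]
      omega
    have hsplit := Finset.sum_sdiff (f := f) hSN
    have hinsert : ∀ x ∈ N \ S, |f x + ∑ y ∈ S, f y| ≤ 1 →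
        ∃ T ⊆ N, T.card = k + 1 ∧ |∑ y ∈ T, f y| ≤ 1 := by
      intro x hx h
      obtain ⟨hxN, hxS⟩ := Finset.mem_sdiff.mp hx
      refine ⟨insert x S, Finset.insert_subset hxN hSN, ?_, ?_⟩
      · rw [Finset.card_insert_of_notMem hxS, hcard]
      · rwa [Finset.sum_insert hxS]
    rw [abs_le] at hS
    rcases le_total 0 (∑ y ∈ S, f y) with h | h
    · obtain ⟨x, hx, hfx⟩ := Finset.exists_le_of_sum_le (f := f) (g := fun _ => 0) hne
        (by simp only [Finset.sum_const_zero]; linarith)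
      have hb := abs_le.mp (hf x (Finset.mem_sdiff.mp hx).1)
      exact hinsert x hx (abs_le.mpr ⟨by linarith, by linarith⟩)
    · obtain ⟨x, hx, hfx⟩ := Finset.exists_le_of_sum_le (f := fun _ => 0) (g := f) hne
        (by simp only [Finset.sum_const_zero]; linarith)
      have hb := abs_le.mp (hf x (Finset.mem_sdiff.mp hx).1)
      exact hinsert x hx (abs_le.mpr ⟨by linarith, by linarith⟩)

/-- Balancing claim: among all `k`-element subsets of a finite set carrying
`[0,1]`-valued weights, some subset's total weight is within 1 of the
proportional share `k` times the average weight. -/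
theorem stmt_0 {α : Type*} (N : Finset α) (hN : N.Nonempty)
    (m : α → ℝ) (hm : ∀ x ∈ N, 0 ≤ m x ∧ m x ≤ 1)
    (k : ℕ) (hk : k ≤ N.card)
    (d : ℝ) (hd : d = (k : ℝ) * (∑ x ∈ N, m x) / (N.card : ℝ)) :
    ∃ S ⊆ N, S.card = k ∧ d - 1 ≤ ∑ x ∈ S, m x ∧ ∑ x ∈ S, m x ≤ d + 1 := by
  have hpos : (0 : ℝ) < N.card := by exact_mod_cast hN.card_pos
  set a : ℝ := (∑ x ∈ N, m x) / N.card with ha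
  have ha0 : 0 ≤ a := div_nonneg (Finset.sum_nonneg fun x hx => (hm x hx).1) hpos.le
  have ha1 : a ≤ 1 := by
    rw [ha, div_le_one hpos]
    simpa using Finset.sum_le_sum fun x hx => (hm x hx).2
  obtain ⟨S, hSN, hcard, hS⟩ := exists_subset_card_eq_abs_sum_le_one N (fun x => m x - a)
    (fun x hx => abs_le.mpr ⟨by linarith [(hm x hx).1], by linarith [(hm x hx).2]⟩)
    (by
      rw [Finset.sum_sub_distrib, Finset.sum_const, nsmul_eq_mul, ha,
        mul_div_cancel₀ _ hpos.ne', sub_self]) k hk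
  rw [Finset.sum_sub_distrib, Finset.sum_const, nsmul_eq_mul, hcard, abs_le] at hS
  rw [mul_div_assoc, ← ha] at hd
  exact ⟨S, hSN, hcard, by linarith, by linarith⟩
end

section
/- Let λ > 1 and k > 0 be real numbers, and let p : ℕ → ℝ satisfy p(0) = 0 and, for every i ≥ 1, |p(i) − (1 − p(i−1))/(λ+1)| ≤ 1/(k·λ^i). Then for every i ∈ ℕ, |p(i) − (1/(λ+2))·(1 − (−1/(λ+1))^i)| ≤ i/(k·λ^i). -/
/-- Closed-form solution with error propagation (Equation (2)) for the recursion
`p i = (1 - p (i-1))/(λ+1) + ε₁ i` with `|ε₁ i| ≤ 1/(k·λ^i)`. -/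
theorem stmt_2 (l k : ℝ) (hl : 1 < l) (hk : 0 < k) (p : ℕ → ℝ)
    (hp0 : p 0 = 0)
    (hrec : ∀ i : ℕ, 1 ≤ i → |p i - (1 - p (i - 1)) / (l + 1)| ≤ 1 / (k * l ^ i)) :
    ∀ i : ℕ, |p i - (1 / (l + 2)) * (1 - (-1 / (l + 1)) ^ i)| ≤ (i : ℝ) / (k * l ^ i) := by
  have hl0 : 0 < l := by linarith
  have hl1 : 0 < l + 1 := by linarith
  have hl2 : 0 < l + 2 := by linarith
  intro i
  induction i with
  | zero => simp [hp0]
  | succ n ih =>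
    have h := hrec (n + 1) (by omega)
    rw [Nat.add_sub_cancel] at h
    have decomp : p (n + 1) - (1 / (l + 2)) * (1 - (-1 / (l + 1)) ^ (n + 1)) =
        (p (n + 1) - (1 - p n) / (l + 1)) -
          (p n - (1 / (l + 2)) * (1 - (-1 / (l + 1)) ^ n)) / (l + 1) := by
      rw [pow_succ]
      generalize (-1 / (l + 1)) ^ n = x
      field_simp
      ring
    have contraction : |(p n - (1 / (l + 2)) * (1 - (-1 / (l + 1)) ^ n)) / (l + 1)| ≤
        (n : ℝ) / (k * l ^ (n + 1)) := by
      rw [abs_div, abs_of_pos hl1]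
      calc _ ≤ (n : ℝ) / (k * l ^ n) / l := by
            gcongr
            linarith
        _ = (n : ℝ) / (k * l ^ (n + 1)) := by rw [div_div, pow_succ, mul_assoc]
    rw [decomp]
    calc _ ≤ 1 / (k * l ^ (n + 1)) + (n : ℝ) / (k * l ^ (n + 1)) :=
          (abs_sub _ _).trans (add_le_add h contraction)
      _ = ((n + 1 : ℕ) : ℝ) / (k * l ^ (n + 1)) := by
          push_cast
          ring
end

section
/- Let n and η be natural numbers with 1 ≤ η ≤ n, and let p be a real number such that p + ∑_{j=1}^{η−1} 1/(n − j + 1) ≤ 1. Then η/n ≤ 1 − exp(−(1 − p)) + 2/n. -/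
theorem add_one_mul_exp_neg_one_div_le {x : ℝ} (hx : 0 < x) :
    (x + 1) * Real.exp (-(1 / x)) ≤ x := by
  have h := Real.add_one_le_exp (1 / x)
  rw [Real.exp_neg, ← div_eq_mul_inv, div_le_iff₀ (Real.exp_pos _)]
  calc x + 1 = x * (1 / x + 1) := by field_simp; ring
    _ ≤ x * Real.exp (1 / x) := by gcongr

theorem add_one_mul_exp_neg_sum_one_div_le (n k : ℕ) (hk : k ≤ n) :
    ((n : ℝ) + 1) * Real.exp (-∑ j ∈ Finset.Icc 1 k, (1 : ℝ) / ((n : ℝ) - (j : ℝ) + 1)) ≤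
      (n : ℝ) - k + 1 := by
  induction k with
  | zero => simp
  | succ k ih =>
    have hpos : (0 : ℝ) < (n : ℝ) - k := sub_pos.mpr (by exact_mod_cast hk)
    rw [Finset.sum_Icc_succ_top (by omega), neg_add, Real.exp_add, ← mul_assoc]
    push_cast
    rw [show (n : ℝ) - (k + 1) + 1 = n - k by ring]
    exact (mul_le_mul_of_nonneg_right (ih (by omega)) (Real.exp_pos _).le).trans
      (add_one_mul_exp_neg_one_div_le hpos)

/-- Analytic core of Lemma 3: if an initial value `p` plus the harmonic-type sum
`∑_{j=1}^{η-1} 1/(n-j+1)` does not exceed 1, then `η/n ≤ 1 - e^{-(1-p)} + 2/n`. -/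
theorem stmt_5 (n η : ℕ) (hη1 : 1 ≤ η) (hηn : η ≤ n) (p : ℝ)
    (hsum : p + ∑ j ∈ Finset.Icc 1 (η - 1), (1 : ℝ) / ((n : ℝ) - (j : ℝ) + 1) ≤ 1) :
    (η : ℝ) / (n : ℝ) ≤ 1 - Real.exp (-(1 - p)) + 2 / (n : ℝ) := by
  have hn : (0 : ℝ) < n := by exact_mod_cast hη1.trans hηn
  have h := add_one_mul_exp_neg_sum_one_div_le n (η - 1) (by omega)
  rw [Nat.cast_sub hη1, Nat.cast_one] at h
  have hexp : Real.exp (-(1 - p)) ≤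
      Real.exp (-∑ j ∈ Finset.Icc 1 (η - 1), (1 : ℝ) / ((n : ℝ) - (j : ℝ) + 1)) :=
    Real.exp_le_exp.mpr (by linarith)
  have hmul := mul_le_mul_of_nonneg_left hexp (by linarith : (0 : ℝ) ≤ (n : ℝ) + 1)
  have hkey : (η : ℝ) ≤ (1 - Real.exp (-(1 - p))) * n + 2 := by
    linarith [Real.exp_pos (-(1 - p))]
  rw [div_le_iff₀ hn, add_mul, div_mul_cancel₀ _ hn.ne']
  exact hkey
end

section
/- Let λ, γ₁, γ₂, γ₃ > 1 be real numbers and γ̄ := γ₁ + γ₁γ₂ + γ₁γ₂γ₃. For h ∈ ℕ write x_h := (−1/(λ+1))^h, y_h := λ^{−h}, and D_h := 2(λ − y_h + γ̄(λ−1)). Define R(h) := (λ − y_h + γ₁(γ₂+1)(λ−1))/D_h + ((λ−1)/(λ+2))·((1−y_h)/(λ−1) − (x_h − y_h)/(2λ+1))/D_h + ((λ+1)(λ−1)(1 − (−1/(λ+1))^{h+1}))/((λ+2)(γ₁+1)·D_h) + γ₁(λ−1)·(γ₁(λ+2)+1−x_h)/((γ₂+1)(γ₁+1)(λ+2)·D_h)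 + γ₁γ₂(λ−1)·(γ₂(γ₁+1)(λ+2)+(λ+1)+x_h)/((γ₂+1)(γ₁+1)(λ+2)·D_h) + (2γ₁γ₂γ₃(λ−1)/D_h)·(1 − exp(−1 + (γ₂(γ₁+1)(λ+2)+(λ+1)+x_h)/((γ₃+1)(γ₂+1)(γ₁+1)(λ+2)))). Then R(h) converges, as h → ∞, to F₃(λ,γ₁,γ₂,γ₃) := (λ + γ₁(γ₂+1)(λ−1))/(2(λ + γ̄(λ−1))) + (λ² + γ₁)/(2(λ+2)(γ₁+1)(λ + γ̄(λ−1))) + (γ₁(λ−1))/(2(λ + γ̄(λ−1))) · (γ₁(λ+2)+1)/((γ₂+1)(γ₁+1)(λ+2)) + (γ₁γ₂(λ−1))/(2(λ + γ̄(λ−1))) · (γ₂(γ₁+1)(λ+2)+(λ+1))/((γ₂+1)(γ₁+1)(λ+2)) + (γ₁γ₂γ₃(λ−1))/(λ + γ̄(λ−1)) · (1 − exp(−(1/(γ₃+1))·(γ₃ + (γ₁(λ+2)+1)/((γ₂+1)(γ₁+1)(λ+2))))). -/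
/-- Limiting (as `h → ∞`) upper bound on the competitive ratio of any fractional
algorithm for fully online matching obtained from the construction with `h`
levels of growth factor `λ` followed by three levels of growth factors
`γ₁, γ₂, γ₃`. -/
noncomputable def F₃ (l g1 g2 g3 : ℝ) : ℝ :=
  let gbar := g1 + g1 * g2 + g1 * g2 * g3
  (l + g1 * (g2 + 1) * (l - 1)) / (2 * (l + gbar * (l - 1)))
    + (l ^ 2 + g1) / (2 * (l + 2) * (g1 + 1) * (l + gbar * (l - 1)))
    + (g1 * (l - 1)) / (2 * (l + gbar * (l - 1))) *
        ((g1 * (l + 2) + 1) / ((g2 + 1) * (g1 + 1) * (l + 2)))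
    + (g1 * g2 * (l - 1)) / (2 * (l + gbar * (l - 1))) *
        ((g2 * (g1 + 1) * (l + 2) + (l + 1)) / ((g2 + 1) * (g1 + 1) * (l + 2)))
    + (g1 * g2 * g3 * (l - 1)) / (l + gbar * (l - 1)) *
        (1 - Real.exp (-(1 / (g3 + 1)) *
          (g3 + (g1 * (l + 2) + 1) / ((g2 + 1) * (g1 + 1) * (l + 2)))))

/-- Master limit computation of the appendix: the ratio `ALG/OPT` of the
construction (error terms removed) converges to the explicit upper bound `F₃`. -/
theorem stmt_12 (l g1 g2 g3 gbar : ℝ) (hl : 1 < l) (hg1 : 1 < g1) (hg2 : 1 < g2)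
    (hg3 : 1 < g3) (hgbar : gbar = g1 + g1 * g2 + g1 * g2 * g3)
    (x y D R : ℕ → ℝ)
    (hx : ∀ h : ℕ, x h = (-1 / (l + 1)) ^ h)
    (hy : ∀ h : ℕ, y h = l ^ (-(h : ℤ)))
    (hD : ∀ h : ℕ, D h = 2 * (l - y h + gbar * (l - 1)))
    (hR : ∀ h : ℕ, R h =
      (l - y h + g1 * (g2 + 1) * (l - 1)) / D h
        + ((l - 1) / (l + 2)) *
            ((1 - y h) / (l - 1) - (x h - y h) / (2 * l + 1)) / D h
        + ((l + 1) * (l - 1) * (1 - (-1 / (l + 1)) ^ (h + 1))) /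
            ((l + 2) * (g1 + 1) * D h)
        + g1 * (l - 1) * (g1 * (l + 2) + 1 - x h) /
            ((g2 + 1) * (g1 + 1) * (l + 2) * D h)
        + g1 * g2 * (l - 1) * (g2 * (g1 + 1) * (l + 2) + (l + 1) + x h) /
            ((g2 + 1) * (g1 + 1) * (l + 2) * D h)
        + (2 * g1 * g2 * g3 * (l - 1) / D h) *
            (1 - Real.exp (-1 + (g2 * (g1 + 1) * (l + 2) + (l + 1) + x h) /
              ((g3 + 1) * (g2 + 1) * (g1 + 1) * (l + 2))))) :
    Filter.Tendsto R Filter.atTop (nhds (F₃ l g1 g2 g3)) := by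
  have hxlim : Filter.Tendsto (fun h : ℕ => (-1 / (l + 1)) ^ h) Filter.atTop (nhds 0) := by
    apply tendsto_pow_atTop_nhds_zero_of_abs_lt_one
    rw [abs_div, abs_neg, abs_one, abs_of_pos (by linarith), div_lt_one (by linarith)]
    linarith
  have hxlim' := hxlim.comp (Filter.tendsto_add_atTop_nat 1)
  have hylim : Filter.Tendsto y Filter.atTop (nhds 0) := by
    have hpow : Filter.Tendsto (fun h : ℕ => l⁻¹ ^ h) Filter.atTop (nhds 0) :=
      tendsto_pow_atTop_nhds_zero_of_lt_one (by positivity) (inv_lt_one_of_one_lt₀ hl)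
    refine hpow.congr fun h => ?_
    rw [hy, zpow_neg, zpow_natCast, inv_pow]
  have hl' : 0 < l - 1 := by linarith
  have hgpos : 0 < gbar := by rw [hgbar]; positivity
  have hLpos : 0 < l + gbar * (l - 1) := by positivity
  have hDlim : Filter.Tendsto D Filter.atTop (nhds (2 * (l + gbar * (l - 1)))) := by
    rw [funext hD]
    simpa using ((hylim.const_sub l).add_const (gbar * (l - 1))).const_mul 2
  have hD0 : 2 * (l + gbar * (l - 1)) ≠ 0 := by positivity
  rw [← funext hx] at hxlim
  have hl2 : l + 2 ≠ 0 := by positivity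
  have hg1' : g1 + 1 ≠ 0 := by positivity
  have hg2' : g2 + 1 ≠ 0 := by positivity
  have hg3' : g3 + 1 ≠ 0 := by positivity
  have key := ((((((hylim.const_sub l).add_const (g1 * (g2 + 1) * (l - 1))).div hDlim hD0).add
    ((((((hylim.const_sub 1).div_const (l - 1)).sub
      ((hxlim.sub hylim).div_const (2 * l + 1))).const_mul ((l - 1) / (l + 2))).div
        hDlim hD0))).add
    (((hxlim'.const_sub 1).const_mul ((l + 1) * (l - 1))).div
      (hDlim.const_mul ((l + 2) * (g1 + 1))) (by positivity))).add
    (((hxlim.const_sub (g1 * (l + 2) + 1)).const_mul (g1 * (l - 1))).div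
      (hDlim.const_mul ((g2 + 1) * (g1 + 1) * (l + 2))) (by positivity))).add
    (((hxlim.const_add (g2 * (g1 + 1) * (l + 2) + (l + 1))).const_mul (g1 * g2 * (l - 1))).div
      (hDlim.const_mul ((g2 + 1) * (g1 + 1) * (l + 2))) (by positivity)) |>.add
    (((tendsto_const_nhds (x := 2 * g1 * g2 * g3 * (l - 1))).div hDlim hD0).mul
      ((((hxlim.const_add (g2 * (g1 + 1) * (l + 2) + (l + 1))).div_const
        ((g3 + 1) * (g2 + 1) * (g1 + 1) * (l + 2))).const_add (-1)).rexp.const_sub 1))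
  have hexp : -(1 / (g3 + 1)) * (g3 + (g1 * (l + 2) + 1) / ((g2 + 1) * (g1 + 1) * (l + 2))) =
      -1 + (g2 * (g1 + 1) * (l + 2) + (l + 1) + 0) /
        ((g3 + 1) * (g2 + 1) * (g1 + 1) * (l + 2)) := by
    field_simp
    ring
  convert key.congr fun h => (hR h).symm using 2
  unfold F₃
  simp only [← hgbar]
  rw [hexp]
  generalize Real.exp _ = E
  generalize l + gbar * (l - 1) = L at *
  field_simp
  ring
end
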